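/- Let d ≥ 2 and let A, B, C, D be arbitrary d×d complex matrices. Then ∫ Tr(W A Wᴴ B)·Tr(W C Wᴴ D) dW over U(d) with Haar measure equals (Tr(A)Tr(B)Tr(C)Tr(D) + Tr(AC)Tr(BD))/(d²−1) − (Tr(AC)Tr(B)Tr(D) + Tr(A)Tr(C)Tr(BD))/(d(d²−1)). -/

import Mathlib

open MeasureTheory Matrix

lemma exists_perm_pair {n : Type*} [DecidableEq n] {p q i k : n} (h : p ≠ q) (h' : i ≠ k) :
    ∃ σ : Equiv.Perm n, σ p = i ∧ σ q = k := by
  refine ⟨Equiv.swap (Equiv.swap p i q) k * Equiv.swap p i, ?_, by simp⟩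
  rw [Equiv.Perm.mul_apply, Equiv.swap_apply_left, Equiv.swap_apply_of_ne_of_ne _ h']
  intro hh
  exact h ((Equiv.swap p i).injective (by rw [Equiv.swap_apply_left]; exact hh))

section InvariantTensor

variable {n : Type*} [Fintype n] [DecidableEq n]

/-- A four-index tensor invariant under `U ⊗ star U ⊗ U ⊗ star U` for every unitary `U` (entrywise `star`). -/
def IsUnitaryInvariant (T : n → n → n → n → ℂ) : Prop :=
  ∀ U ∈ unitaryGroup n ℂ, ∀ i j k l, T i j k l =
    ∑ a, U i a * ∑ b, star (U j b) * ∑ c, U k c * ∑ e, star (U l e) * T a b c e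

lemma diagonal_mem_unitaryGroup {z : n → ℂ} (hz : ∀ a, z a * star (z a) = 1) :
    diagonal z ∈ unitaryGroup n ℂ := by
  rw [mem_unitaryGroup_iff, star_eq_conjTranspose, diagonal_conjTranspose, diagonal_mul_diagonal,
    ← diagonal_one]
  exact congrArg diagonal (funext hz)

lemma permMatrix_mem_unitaryGroup (σ : Equiv.Perm n) :
    σ.permMatrix ℂ ∈ unitaryGroup n ℂ := by
  rw [mem_unitaryGroup_iff, star_eq_conjTranspose, conjTranspose_permMatrix, ← permMatrix_mul]
  simp

/-- The reflection acting as `(3, 4; 4, -3) / 5` on the coordinates `p` and `q`. -/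
noncomputable def pairReflection (p q : n) : Matrix n n ℂ :=
  1 - (single p p (2 / 5) - single p q (4 / 5) - single q p (4 / 5) + single q q (8 / 5))

lemma pairReflection_mem_unitaryGroup {p q : n} (h : p ≠ q) :
    pairReflection p q ∈ unitaryGroup n ℂ := by
  have hs : star (pairReflection p q) = pairReflection p q := by
    simp [pairReflection, star_eq_conjTranspose, conjTranspose_single]
    abel
  rw [mem_unitaryGroup_iff, hs]
  ext i j
  simp only [pairReflection, sub_mul, mul_sub, add_mul, mul_add, one_mul, mul_one,
    single_mul_single_same, single_mul_single_of_ne _ _ _ _ h,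
    single_mul_single_of_ne _ _ _ _ h.symm, Matrix.sub_apply, Matrix.add_apply, single_apply,
    Matrix.zero_apply]
  split_ifs <;> norm_num

lemma sum_pairReflection_mul {p q : n} (h : p ≠ q) (f : n → ℂ) :
    ∑ a, pairReflection p q p a * f a = 3 / 5 * f p + 4 / 5 * f q := by
  have h' (a : n) : pairReflection p q p a * f a =
      (if p = a then 3 / 5 * f a else 0) + (if q = a then 4 / 5 * f a else 0) := by
    simp only [pairReflection, Matrix.sub_apply, Matrix.add_apply, single_apply, Matrix.one_apply]
    split_ifs <;> grind
  simp [h', Finset.sum_add_distrib]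

lemma sum_star_pairReflection_mul {p q : n} (h : p ≠ q) (f : n → ℂ) :
    ∑ a, star (pairReflection p q p a) * f a = 3 / 5 * f p + 4 / 5 * f q := by
  have h' (a : n) : star (pairReflection p q p a) = pairReflection p q p a := by
    simp only [pairReflection, Matrix.sub_apply, Matrix.add_apply, single_apply, Matrix.one_apply]
    split_ifs <;> simp
  simp only [h', sum_pairReflection_mul h]

namespace IsUnitaryInvariant

variable {T : n → n → n → n → ℂ}

lemma apply_diagonal (hT : IsUnitaryInvariant T) {z : n → ℂ} (hz : ∀ a, z a * star (z a) = 1)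
    (i j k l : n) : T i j k l = z i * star (z j) * z k * star (z l) * T i j k l := by
  conv_lhs => rw [hT _ (diagonal_mem_unitaryGroup hz) i j k l]
  simp [diagonal_apply, apply_ite, mul_assoc]

lemma apply_perm (hT : IsUnitaryInvariant T) (σ : Equiv.Perm n) (i j k l : n) :
    T i j k l = T (σ i) (σ j) (σ k) (σ l) := by
  conv_lhs => rw [hT _ (permMatrix_mem_unitaryGroup σ) i j k l]
  simp [Equiv.Perm.permMatrix, PEquiv.toMatrix_apply, apply_ite]

/-- An invariant tensor is supported where its upper and lower indices agree as multisets. -/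
lemma eq_zero (hT : IsUnitaryInvariant T) {i j k l : n} (h₁ : ¬(i = j ∧ k = l))
    (h₂ : ¬(i = l ∧ k = j)) : T i j k l = 0 := by
  have key (p : n) := hT.apply_diagonal (z := fun a => if a = p then Complex.I else 1)
    (fun a => by split_ifs <;> simp) i j k l
  have hI : Complex.I ≠ 1 := fun h => by simpa using congrArg Complex.im h
  by_contra hne
  replace key (p : n) := (mul_eq_right₀ hne).1 (key p).symm
  have hi := key i
  have hk := key k
  by_cases hik : i = k
  · subst hik
    by_cases hij : i = j
    · subst hij
      have hl : l ≠ i := fun h => h₁ ⟨rfl, h.symm⟩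
      simp [hl, hI] at hi
    · by_cases hil : i = l
      · subst hil
        simp [Ne.symm hij, hI] at hi
      · norm_num [Ne.symm hij, Ne.symm hil] at hi
  · by_cases hij : i = j
    · subst hij
      have hl : l ≠ k := fun h => h₁ ⟨rfl, h.symm⟩
      simp [hl, hik, hI] at hk
    · by_cases hil : i = l
      · subst hil
        have hj : j ≠ k := fun h => h₂ ⟨rfl, h.symm⟩
        simp [hj, hik, hI] at hk
      · simp [Ne.symm hij, Ne.symm hil, Ne.symm hik, hI] at hi

/-- The fully diagonal entries are determined by the entries on two distinct indices. -/
lemma apply_same (hT : IsUnitaryInvariant T) {p q : n} (h : p ≠ q) :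
    T p p p p = T p p q q + T p q q p := by
  have hR := hT _ (pairReflection_mem_unitaryGroup h) p p p p
  simp only [sum_pairReflection_mul h, sum_star_pairReflection_mul h] at hR
  have e₁ := hT.apply_perm (Equiv.swap p q) p p p p
  have e₂ := hT.apply_perm (Equiv.swap p q) p p q q
  have e₃ := hT.apply_perm (Equiv.swap p q) p q q p
  simp only [Equiv.swap_apply_left, Equiv.swap_apply_right] at e₁ e₂ e₃
  have z₁ := hT.eq_zero (i := p) (j := p) (k := p) (l := q) (by simp [h]) (by simp [h])
  have z₂ := hT.eq_zero (i := p) (j := p) (k := q) (l := p) (by simp [h.symm]) (by simp [h.symm])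
  have z₃ := hT.eq_zero (i := p) (j := q) (k := p) (l := p) (by simp [h]) (by simp [h])
  have z₄ := hT.eq_zero (i := q) (j := p) (k := p) (l := p) (by simp [h.symm]) (by simp [h.symm])
  have z₅ := hT.eq_zero (i := q) (j := q) (k := q) (l := p) (by simp [h.symm]) (by simp [h.symm])
  have z₆ := hT.eq_zero (i := q) (j := q) (k := p) (l := q) (by simp [h]) (by simp [h])
  have z₇ := hT.eq_zero (i := q) (j := p) (k := q) (l := q) (by simp [h.symm]) (by simp [h.symm])
  have z₈ := hT.eq_zero (i := p) (j := q) (k := q) (l := q) (by simp [h]) (by simp [h])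
  have z₉ := hT.eq_zero (i := p) (j := q) (k := p) (l := q) (by simp [h]) (by simp [h])
  have z₀ := hT.eq_zero (i := q) (j := p) (k := q) (l := p) (by simp [h.symm]) (by simp [h.symm])
  rw [z₁, z₂, z₃, z₄, z₅, z₆, z₇, z₈, z₉, z₀, ← e₁, ← e₂, ← e₃] at hR
  linear_combination (625 / 288) * hR

/-- Invariant four-index tensors are spanned by the two pairings of the indices. -/
lemma exists_eq_add [Nontrivial n] (hT : IsUnitaryInvariant T) :
    ∃ α β : ℂ, ∀ i j k l, T i j k l =
      α * (if i = j then 1 else 0) * (if k = l then 1 else 0) +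
        β * (if i = l then 1 else 0) * (if k = j then 1 else 0) := by
  obtain ⟨p, q, hpq⟩ := exists_pair_ne n
  have hα {i k : n} (h : i ≠ k) : T i i k k = T p p q q := by
    obtain ⟨σ, rfl, rfl⟩ := exists_perm_pair hpq h
    exact (hT.apply_perm σ _ _ _ _).symm
  have hβ {i k : n} (h : i ≠ k) : T i k k i = T p q q p := by
    obtain ⟨σ, rfl, rfl⟩ := exists_perm_pair hpq h
    exact (hT.apply_perm σ _ _ _ _).symm
  refine ⟨T p p q q, T p q q p, fun i j k l => ?_⟩
  by_cases h₁ : i = j ∧ k = l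
  · obtain ⟨rfl, rfl⟩ := h₁
    by_cases h : i = k
    · subst h
      obtain ⟨m, hm⟩ := exists_ne i
      simp [hT.apply_same hm.symm, hα hm.symm, hβ hm.symm]
    · simp [h, hα h]
  · by_cases h₂ : i = l ∧ k = j
    · obtain ⟨rfl, rfl⟩ := h₂
      have h : i ≠ k := fun h => h₁ ⟨h, h.symm⟩
      simp [h, hβ h]
    · rw [hT.eq_zero h₁ h₂]
      split_ifs <;> simp_all

end IsUnitaryInvariant

end InvariantTensor

section HaarMoment

variable {d : ℕ}

lemma conj_apply (U M : Matrix (Fin d) (Fin d) ℂ) (i j : Fin d) :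
    (U * M * Uᴴ) i j = ∑ a, ∑ b, U i a * star (U j b) * M a b := by
  simp only [mul_apply, conjTranspose_apply, Finset.sum_mul]
  rw [Finset.sum_comm]
  exact Finset.sum_congr rfl fun _ _ => Finset.sum_congr rfl fun _ _ => by ring

lemma trace_unitary_conj (W : unitaryGroup (Fin d) ℂ) (A : Matrix (Fin d) (Fin d) ℂ) :
    ((W : Matrix (Fin d) (Fin d) ℂ) * A * (W : Matrix (Fin d) (Fin d) ℂ)ᴴ).trace = A.trace := by
  rw [trace_mul_comm, ← mul_assoc, ← star_eq_conjTranspose, UnitaryGroup.star_mul_self, one_mul]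

instance compactSpace_unitaryGroup : CompactSpace (unitaryGroup (Fin d) ℂ) := by
  refine isCompact_iff_compactSpace.1 <| (isCompact_univ_pi fun _ => isCompact_univ_pi fun _ =>
    isCompact_closedBall (0 : ℂ) 1).of_isClosed_subset ?_ fun U hU i _ j _ => ?_
  · have h : (unitaryGroup (Fin d) ℂ : Set (Matrix (Fin d) (Fin d) ℂ)) = {U | U * star U = 1} :=
      Set.ext fun U => mem_unitaryGroup_iff
    rw [h]
    exact isClosed_eq (by fun_prop) continuous_const
  · simpa using entry_norm_bound_of_unitary hU i j

variable [MeasurableSpace (unitaryGroup (Fin d) ℂ)] [BorelSpace (unitaryGroup (Fin d) ℂ)]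
  (μ : Measure (unitaryGroup (Fin d) ℂ))

lemma integrable_conj_entry_mul [IsProbabilityMeasure μ] (A C : Matrix (Fin d) (Fin d) ℂ)
    (i j k l : Fin d) :
    Integrable (fun W : unitaryGroup (Fin d) ℂ =>
      ((W : Matrix (Fin d) (Fin d) ℂ) * A * (W : Matrix (Fin d) (Fin d) ℂ)ᴴ) i j *
        ((W : Matrix (Fin d) (Fin d) ℂ) * C * (W : Matrix (Fin d) (Fin d) ℂ)ᴴ) k l) μ := by
  exact Continuous.integrable_of_hasCompactSupport (by fun_prop) (.of_compactSpace _)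

/-- The entrywise second moment of `W ↦ (W A Wᴴ) ⊗ (W C Wᴴ)`. -/
noncomputable def conjMoment (A C : Matrix (Fin d) (Fin d) ℂ) (i j k l : Fin d) : ℂ :=
  ∫ W : unitaryGroup (Fin d) ℂ,
    ((W : Matrix (Fin d) (Fin d) ℂ) * A * (W : Matrix (Fin d) (Fin d) ℂ)ᴴ) i j *
      ((W : Matrix (Fin d) (Fin d) ℂ) * C * (W : Matrix (Fin d) (Fin d) ℂ)ᴴ) k l ∂μ

variable [IsProbabilityMeasure μ]

lemma isUnitaryInvariant_conjMoment [μ.IsMulLeftInvariant] (A C : Matrix (Fin d) (Fin d) ℂ) :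
    IsUnitaryInvariant (conjMoment μ A C) := by
  intro U hU i j k l
  have hint := integrable_conj_entry_mul μ A C
  rw [conjMoment, ← integral_mul_left_eq_self _ (⟨U, hU⟩ : unitaryGroup (Fin d) ℂ)]
  have hconj (W : unitaryGroup (Fin d) ℂ) (A : Matrix (Fin d) (Fin d) ℂ) :
      (((⟨U, hU⟩ * W : unitaryGroup (Fin d) ℂ) : Matrix (Fin d) (Fin d) ℂ) * A *
        ((⟨U, hU⟩ * W : unitaryGroup (Fin d) ℂ) : Matrix (Fin d) (Fin d) ℂ)ᴴ) =
      U * ((W : Matrix (Fin d) (Fin d) ℂ) * A * (W : Matrix (Fin d) (Fin d) ℂ)ᴴ) * Uᴴ := by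
    simp [conjTranspose_mul, mul_assoc]
  have expand (M N : Matrix (Fin d) (Fin d) ℂ) : (U * M * Uᴴ) i j * (U * N * Uᴴ) k l =
      ∑ a, ∑ b, ∑ c, ∑ e, (U i a * star (U j b) * U k c * star (U l e)) * (M a b * N c e) := by
    simp only [conj_apply, Finset.sum_mul]
    refine Finset.sum_congr rfl fun _ _ => Finset.sum_congr rfl fun _ _ => ?_
    simp only [Finset.mul_sum]
    exact Finset.sum_congr rfl fun _ _ => Finset.sum_congr rfl fun _ _ => by ring
  simp only [hconj, expand]
  simp (discharger := fun_prop) only [integral_finsetSum, integral_const_mul]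
  simp only [Finset.mul_sum, conjMoment, mul_assoc]

lemma sum_conjMoment_mul_eq_integral_sum (A C : Matrix (Fin d) (Fin d) ℂ)
    (c : Fin d → Fin d → Fin d → Fin d → ℂ) :
    ∑ i, ∑ j, ∑ k, ∑ l, conjMoment μ A C i j k l * c i j k l =
      ∫ W : unitaryGroup (Fin d) ℂ, ∑ i, ∑ j, ∑ k, ∑ l,
        ((W : Matrix (Fin d) (Fin d) ℂ) * A * (W : Matrix (Fin d) (Fin d) ℂ)ᴴ) i j *
        ((W : Matrix (Fin d) (Fin d) ℂ) * C * (W : Matrix (Fin d) (Fin d) ℂ)ᴴ) k l *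
        c i j k l ∂μ := by
  have hint := integrable_conj_entry_mul μ A C
  simp (discharger := fun_prop) only [integral_finsetSum, integral_mul_const, conjMoment]

lemma sum_conjMoment_mul (A B C D : Matrix (Fin d) (Fin d) ℂ) :
    ∑ i, ∑ j, ∑ k, ∑ l, conjMoment μ A C i j k l * (B j i * D l k) =
      ∫ W : unitaryGroup (Fin d) ℂ,
        ((W : Matrix (Fin d) (Fin d) ℂ) * A * (W : Matrix (Fin d) (Fin d) ℂ)ᴴ * B).trace *
          ((W : Matrix (Fin d) (Fin d) ℂ) * C * (W : Matrix (Fin d) (Fin d) ℂ)ᴴ * D).trace ∂μ := by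
  rw [sum_conjMoment_mul_eq_integral_sum]
  congr with W
  generalize (W : Matrix (Fin d) (Fin d) ℂ) * A * (W : Matrix (Fin d) (Fin d) ℂ)ᴴ = M
  generalize (W : Matrix (Fin d) (Fin d) ℂ) * C * (W : Matrix (Fin d) (Fin d) ℂ)ᴴ = N
  simp only [trace, diag_apply, Matrix.mul_apply (M := M), Matrix.mul_apply (M := N), Finset.sum_mul]
  refine Finset.sum_congr rfl fun _ _ => Finset.sum_congr rfl fun _ _ => ?_
  simp only [Finset.mul_sum]
  exact Finset.sum_congr rfl fun _ _ => Finset.sum_congr rfl fun _ _ => by ring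

lemma sum_conjMoment_diag (A C : Matrix (Fin d) (Fin d) ℂ) :
    ∑ i, ∑ k, conjMoment μ A C i i k k = A.trace * C.trace := by
  have h := sum_conjMoment_mul μ A 1 C 1
  simp only [mul_one, trace_unitary_conj] at h
  simpa [Matrix.one_apply] using h

lemma sum_conjMoment_cross (A C : Matrix (Fin d) (Fin d) ℂ) :
    ∑ i, ∑ k, conjMoment μ A C i k k i = (A * C).trace := by
  have hint := integrable_conj_entry_mul μ A C
  have hsum (W : unitaryGroup (Fin d) ℂ) : ∑ i, ∑ k,
      ((W : Matrix (Fin d) (Fin d) ℂ) * A * (W : Matrix (Fin d) (Fin d) ℂ)ᴴ) i k *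
        ((W : Matrix (Fin d) (Fin d) ℂ) * C * (W : Matrix (Fin d) (Fin d) ℂ)ᴴ) k i =
      (A * C).trace := by
    have hW : (W : Matrix (Fin d) (Fin d) ℂ)ᴴ * W = 1 := UnitaryGroup.star_mul_self W
    rw [← trace_unitary_conj W (A * C)]
    have : (W : Matrix (Fin d) (Fin d) ℂ) * (A * C) * (W : Matrix (Fin d) (Fin d) ℂ)ᴴ =
        (W * A * (W : Matrix (Fin d) (Fin d) ℂ)ᴴ) * (W * C * (W : Matrix (Fin d) (Fin d) ℂ)ᴴ) := by
      calc _ = (W : Matrix (Fin d) (Fin d) ℂ) * A * 1 * C * (W : Matrix (Fin d) (Fin d) ℂ)ᴴ := by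
            simp only [mul_assoc, one_mul]
        _ = _ := by rw [← hW]; simp only [mul_assoc]
    rw [this]
    exact Finset.sum_congr rfl fun _ _ => (Matrix.mul_apply ..).symm
  calc _ = ∫ W : unitaryGroup (Fin d) ℂ, ∑ i, ∑ k,
      ((W : Matrix (Fin d) (Fin d) ℂ) * A * (W : Matrix (Fin d) (Fin d) ℂ)ᴴ) i k *
        ((W : Matrix (Fin d) (Fin d) ℂ) * C * (W : Matrix (Fin d) (Fin d) ℂ)ᴴ) k i ∂μ := by
        simp (discharger := fun_prop) only [integral_finsetSum, conjMoment]
    _ = _ := by simp [hsum]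

end HaarMoment

/-- **Second-moment Haar average over the unitary group.**
For `d ≥ 2` and arbitrary `d × d` complex matrices `A, B, C, D`, the Haar average of
`W ↦ Tr(W A Wᴴ B)·Tr(W C Wᴴ D)` over `U(d)` equals
`(Tr(A)Tr(B)Tr(C)Tr(D) + Tr(AC)Tr(BD))/(d²−1)
  − (Tr(AC)Tr(B)Tr(D) + Tr(A)Tr(C)Tr(BD))/(d(d²−1))`. -/
theorem haar_integral_trace_conj_sq (d : ℕ) (hd : 2 ≤ d)
    (A B C D : Matrix (Fin d) (Fin d) ℂ)
    [MeasurableSpace (Matrix.unitaryGroup (Fin d) ℂ)]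
    [BorelSpace (Matrix.unitaryGroup (Fin d) ℂ)]
    (μ : Measure (Matrix.unitaryGroup (Fin d) ℂ))
    [IsProbabilityMeasure μ] [μ.IsMulLeftInvariant] :
    ∫ W : Matrix.unitaryGroup (Fin d) ℂ,
        ((W : Matrix (Fin d) (Fin d) ℂ) * A * (W : Matrix (Fin d) (Fin d) ℂ)ᴴ * B).trace *
          ((W : Matrix (Fin d) (Fin d) ℂ) * C * (W : Matrix (Fin d) (Fin d) ℂ)ᴴ * D).trace ∂μ
      = (A.trace * B.trace * C.trace * D.trace + (A * C).trace * (B * D).trace)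
          / ((d : ℂ) ^ 2 - 1)
        - ((A * C).trace * B.trace * D.trace + A.trace * C.trace * (B * D).trace)
          / ((d : ℂ) * ((d : ℂ) ^ 2 - 1)) := by
  have : Nontrivial (Fin d) := Fin.nontrivial_iff_two_le.2 hd
  obtain ⟨α, β, hT⟩ := (isUnitaryInvariant_conjMoment μ A C).exists_eq_add
  have h₁ := sum_conjMoment_diag μ A C
  have h₂ := sum_conjMoment_cross μ A C
  rw [← sum_conjMoment_mul]
  have h₃ : ∑ i, ∑ j, ∑ k, ∑ l, conjMoment μ A C i j k l * (B j i * D l k) =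
      α * (B.trace * D.trace) + β * (B * D).trace := by
    simp only [hT, add_mul, Finset.sum_add_distrib]
    congr 1
    · rw [trace, trace, Finset.sum_mul_sum]
      simp [Finset.mul_sum]
    · simp [trace, mul_apply, Finset.mul_sum]
      rw [Finset.sum_comm]
  rw [h₃]
  simp [hT, Finset.sum_add_distrib] at h₁ h₂
  have hd0 : (d : ℂ) ≠ 0 := by exact_mod_cast (by omega : d ≠ 0)
  have hd1 : (d : ℂ) ^ 2 - 1 ≠ 0 := by
    rw [sub_ne_zero]
    exact_mod_cast (by nlinarith : d ^ 2 ≠ 1)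
  field_simp
  linear_combination (B.trace * D.trace * d - (B * D).trace) * h₁ +
    ((B * D).trace * d - B.trace * D.trace) * h₂
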